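/- arXiv:2001.00602 — 2 statements merged into one kernel-verified Lean document; each statement's English description precedes it below -/
import Mathlib

section
/- Let A be a real d×d matrix, b ∈ ℝ^d, and ω* ∈ ℝ^d a point with Aω* + b = 0. Suppose a sequence (ω_t)_{t≥0} in ℝ^d satisfies, for every t ≥ 0, ω_{t+1} = Σ_{k=0}^t α_k^{(t)} (Aω_k + b) + β_k^{(t)} ω_k for some real coefficients with Σ_{k=0}^t β_k^{(t)} = 1. Then for every t ≥ 0 there exists a real polynomial p_t of degree at most t with p_t(0) = 1 such that ω_t − ω* = p_t(A)(ω_0 − ω*). -/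
/-- If `A ω* + b = 0` and a sequence satisfies
`ω_{t+1} = Σ_{k=0}^t α_k^{(t)} (A ω_k + b) + β_k^{(t)} ω_k` with `Σ_k β_k^{(t)} = 1`,
then for every `t` there is a real polynomial `p_t` of degree at most `t` with
`p_t(0) = 1` and `ω_t − ω* = p_t(A)(ω_0 − ω*)`. -/
theorem stmt_0 (d : ℕ) (A : Matrix (Fin d) (Fin d) ℝ) (b ωstar : Fin d → ℝ)
    (hstar : A.mulVec ωstar + b = 0)
    (ω : ℕ → Fin d → ℝ) (α β : ℕ → ℕ → ℝ)
    (hβ : ∀ t : ℕ, ∑ k ∈ Finset.range (t + 1), β t k = 1)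
    (hrec : ∀ t : ℕ, ω (t + 1) =
      ∑ k ∈ Finset.range (t + 1), (α t k • (A.mulVec (ω k) + b) + β t k • ω k)) :
    ∀ t : ℕ, ∃ p : Polynomial ℝ, p.natDegree ≤ t ∧ p.eval 0 = 1 ∧
      ω t - ωstar = (Polynomial.aeval A p).mulVec (ω 0 - ωstar) := by
  intro t
  induction t using Nat.strong_induction_on with
  | _ t ih =>
  cases t with
  | zero => exact ⟨1, by simp, by simp, by simp⟩
  | succ t =>
    have ih' : ∀ k, ∃ p : Polynomial ℝ, k < t + 1 → p.natDegree ≤ k ∧ p.eval 0 = 1 ∧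
        ω k - ωstar = (Polynomial.aeval A p).mulVec (ω 0 - ωstar) := by
      intro k
      by_cases hk : k < t + 1
      · obtain ⟨p, hp⟩ := ih k hk
        exact ⟨p, fun _ => hp⟩
      · exact ⟨0, fun h => absurd h hk⟩
    choose p hp using ih'
    refine ⟨∑ k ∈ Finset.range (t + 1),
      (Polynomial.C (α t k) * Polynomial.X * p k + Polynomial.C (β t k) * p k), ?_, ?_, ?_⟩
    · refine Polynomial.natDegree_sum_le_of_forall_le _ _ fun k hk => ?_
      have hk' := Finset.mem_range.mp hk
      have hdeg := (hp k hk').1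
      refine Polynomial.natDegree_add_le_of_degree_le ?_ ?_
      · refine Polynomial.natDegree_mul_le.trans ?_
        have := (Polynomial.natDegree_C_mul_le (α t k) Polynomial.X).trans Polynomial.natDegree_X_le
        omega
      · exact (Polynomial.natDegree_C_mul_le _ _).trans (by omega)
    · rw [Polynomial.eval_finsetSum, ← hβ t]
      refine Finset.sum_congr rfl fun k hk => ?_
      simp [(hp k (Finset.mem_range.mp hk)).2.1]
    · have hsum : ωstar = ∑ k ∈ Finset.range (t + 1), β t k • ωstar := by
        rw [← Finset.sum_smul, hβ, one_smul]
      rw [hrec, map_sum, Matrix.sum_mulVec]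
      nth_rewrite 1 [hsum]
      rw [← Finset.sum_sub_distrib]
      refine Finset.sum_congr rfl fun k hk => ?_
      have hres : A.mulVec (ω k) + b = A.mulVec (ω k - ωstar) := by
        rw [Matrix.mulVec_sub, eq_neg_of_add_eq_zero_left hstar, sub_neg_eq_add]
      rw [hres, add_sub_assoc, ← smul_sub, (hp k (Finset.mem_range.mp hk)).2.2]
      simp only [map_add, map_mul, Polynomial.aeval_C, Polynomial.aeval_X,
        Algebra.algebraMap_eq_smul_one, smul_mul_assoc, one_mul, Matrix.add_mulVec,
        Matrix.smul_mulVec, Matrix.mulVec_mulVec]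
end

section
/- Let A be a real d×d matrix whose singular values all lie in [γ, L] with 0 < γ ≤ L, and whose symmetric part satisfies (A + Aᵀ)/2 ⪰ μ I_d for some μ ≥ 0. Let τ > 0 satisfy τγ² ≥ μ. Then every complex eigenvalue λ of A + τAᵀA satisfies μ + τγ² ≤ Re λ ≤ L + τL² and |Im λ| ≤ (γ/(μ + τγ²)) · Re λ. -/
open Matrix

/-- The spectrum (set of complex eigenvalues) of a real square matrix. -/
noncomputable def realSpectrum {n : Type*} [Fintype n] [DecidableEq n]
    (A : Matrix n n ℝ) : Set ℂ :=
  spectrum ℂ (A.map (algebraMap ℝ ℂ))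

lemma dotProduct_transpose_mul_self_mulVec {n : Type*} [Fintype n]
    (A : Matrix n n ℝ) (u w : n → ℝ) :
    u ⬝ᵥ ((Aᵀ * A) *ᵥ w) = (A *ᵥ u) ⬝ᵥ (A *ᵥ w) := by
  rw [← mulVec_mulVec, dotProduct_mulVec, vecMul_transpose]

section QuadraticForms

variable {n : Type*} [Fintype n] [DecidableEq n]

/-- A lower bound on the spectrum of a real symmetric matrix bounds its quadratic form below. -/
lemma mul_dotProduct_le_of_spectrum_ge {M : Matrix n n ℝ} (hM : M.IsHermitian) {c : ℝ}
    (h : ∀ s ∈ spectrum ℝ M, c ≤ s) (u : n → ℝ) : c * (u ⬝ᵥ u) ≤ u ⬝ᵥ (M *ᵥ u) := by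
  have hH : (M - algebraMap ℝ (Matrix n n ℝ) c).IsHermitian := by
    rw [Algebra.algebraMap_eq_smul_one]
    exact hM.sub (by simp [Matrix.IsHermitian])
  have hP : (M - algebraMap ℝ (Matrix n n ℝ) c).PosSemidef := by
    rw [hH.posSemidef_iff_eigenvalues_nonneg]
    intro i
    have hi := hH.eigenvalues_mem_spectrum_real i
    rw [← spectrum.sub_singleton_eq] at hi
    obtain ⟨s, hs, r, rfl, hsr⟩ := hi
    have := h s hs
    simp only at hsr
    rw [← hsr]
    simpa using this
  have := hP.dotProduct_mulVec_nonneg u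
  rw [Algebra.algebraMap_eq_smul_one] at this
  simpa [sub_mulVec, smul_mulVec, dotProduct_sub, dotProduct_smul] using this

/-- An upper bound on the spectrum of a real symmetric matrix bounds its quadratic form above. -/
lemma dotProduct_le_mul_of_spectrum_le {M : Matrix n n ℝ} (hM : M.IsHermitian) {c : ℝ}
    (h : ∀ s ∈ spectrum ℝ M, s ≤ c) (u : n → ℝ) : u ⬝ᵥ (M *ᵥ u) ≤ c * (u ⬝ᵥ u) := by
  have h' : ∀ s ∈ spectrum ℝ (-M), -c ≤ s := by
    intro s hs
    rw [← spectrum.neg_eq, Set.mem_neg] at hs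
    linarith [h _ hs]
  have := mul_dotProduct_le_of_spectrum_ge hM.neg h' u
  simp only [neg_mulVec, dotProduct_neg] at this
  linarith

/-- A complex eigenvalue of a real matrix, written through the real and imaginary parts of an
eigenvector. -/
lemma exists_re_im_of_mem_realSpectrum {B : Matrix n n ℝ} {z : ℂ} (hz : z ∈ realSpectrum B) :
    ∃ u w : n → ℝ, 0 < u ⬝ᵥ u + w ⬝ᵥ w ∧
      B *ᵥ u = z.re • u - z.im • w ∧ B *ᵥ w = z.re • w + z.im • u := by
  rw [realSpectrum, ← Matrix.spectrum_toLin', ← Module.End.hasEigenvalue_iff_mem_spectrum] at hz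
  obtain ⟨v, hv⟩ := hz.exists_hasEigenvector
  have hBv := hv.apply_eq_smul
  rw [Matrix.toLin'_apply] at hBv
  refine ⟨fun i => (v i).re, fun i => (v i).im, ?_, ?_, ?_⟩
  · obtain ⟨i, hi⟩ := Function.ne_iff.mp hv.2
    simp only [dotProduct, ← Finset.sum_add_distrib, ← Complex.normSq_apply]
    exact Finset.sum_pos' (fun j _ => Complex.normSq_nonneg _)
      ⟨i, Finset.mem_univ i, Complex.normSq_pos.mpr hi⟩
  · ext i
    have := congrArg Complex.re (congrFun hBv i)
    simpa [mulVec, dotProduct] using this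
  · ext i
    have := congrArg Complex.im (congrFun hBv i)
    simpa [mulVec, dotProduct] using this

end QuadraticForms

/-- With `x + iy` the field of values of a matrix at a unit vector and `s` the norm of the image of
that vector, the shifted point `(x + τ s²) + iy` lies in the stated sector. -/
lemma sector_bounds {γ L μ τ x y s : ℝ} (hγ : 0 < γ) (hμ : 0 ≤ μ) (hτ : 0 < τ)
    (hτγ : μ ≤ τ * γ ^ 2) (hγs : γ ≤ s) (hsL : s ≤ L) (hμx : μ ≤ x) (hxs : x ≤ s)
    (hys : |y| ≤ s) :
    μ + τ * γ ^ 2 ≤ x + τ * s ^ 2 ∧ x + τ * s ^ 2 ≤ L + τ * L ^ 2 ∧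
      |y| ≤ γ / (μ + τ * γ ^ 2) * (x + τ * s ^ 2) := by
  have hs : 0 < s := hγ.trans_le hγs
  refine ⟨by gcongr, by gcongr; linarith, ?_⟩
  have hD : 0 < μ + τ * γ ^ 2 := by positivity
  rw [div_mul_eq_mul_div, le_div_iff₀ hD]
  have h1 : μ ≤ τ * γ * s := hτγ.trans (by
    nlinarith [mul_le_mul_of_nonneg_left hγs (mul_pos hτ hγ).le])
  calc |y| * (μ + τ * γ ^ 2) ≤ s * (μ + τ * γ ^ 2) := by gcongr
    _ ≤ γ * (μ + τ * s ^ 2) := by nlinarith [mul_nonneg (sub_nonneg.2 h1) (sub_nonneg.2 hγs)]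
    _ ≤ γ * (x + τ * s ^ 2) := by gcongr

/-- Let `A` be real `d×d` with all singular values in `[γ, L]`
(`0 < γ ≤ L`), i.e. all eigenvalues of `AAᵀ` in `[γ², L²]`, and with symmetric part
`(A + Aᵀ)/2 ⪰ μ I` for some `μ ≥ 0`. If `τ > 0` satisfies `τγ² ≥ μ`, then every
complex eigenvalue `λ` of `A + τAᵀA` satisfies `μ + τγ² ≤ Re λ ≤ L + τL²` and
`|Im λ| ≤ (γ/(μ + τγ²))·Re λ`. -/
theorem stmt_12 (d : ℕ) (γ L μ τ : ℝ) (hγ : 0 < γ) (hγL : γ ≤ L) (hμ : 0 ≤ μ)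
    (hτ : 0 < τ) (hτγ : μ ≤ τ * γ ^ 2)
    (A : Matrix (Fin d) (Fin d) ℝ)
    (hsv : ∀ s ∈ spectrum ℝ (A * Aᵀ), γ ^ 2 ≤ s ∧ s ≤ L ^ 2)
    (hmono : ((1 / 2 : ℝ) • (A + Aᵀ) - μ • 1).PosSemidef) :
    ∀ lam ∈ realSpectrum (A + τ • (Aᵀ * A)),
      μ + τ * γ ^ 2 ≤ lam.re ∧ lam.re ≤ L + τ * L ^ 2 ∧
        |lam.im| ≤ γ / (μ + τ * γ ^ 2) * lam.re := by
  intro lam hlam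
  obtain ⟨u, w, hN, hu, hw⟩ := exists_re_im_of_mem_realSpectrum hlam
  have hH : (Aᵀ * A).IsHermitian := by
    simp [Matrix.IsHermitian, conjTranspose_eq_transpose_of_trivial]
  have hsp : ∀ s ∈ spectrum ℝ (Aᵀ * A), γ ^ 2 ≤ s ∧ s ≤ L ^ 2 := by
    intro s hs
    rw [mem_spectrum_iff_isRoot_charpoly, charpoly_mul_comm,
      ← mem_spectrum_iff_isRoot_charpoly] at hs
    exact hsv s hs
  have hlow := mul_dotProduct_le_of_spectrum_ge hH fun s hs => (hsp s hs).1
  have hupp := dotProduct_le_mul_of_spectrum_le hH fun s hs => (hsp s hs).2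
  have hsym : ∀ v : Fin d → ℝ, μ * (v ⬝ᵥ v) ≤ v ⬝ᵥ (A *ᵥ v) := by
    intro v
    have h := hmono.dotProduct_mulVec_nonneg v
    have ht : v ⬝ᵥ (Aᵀ *ᵥ v) = v ⬝ᵥ (A *ᵥ v) := by
      rw [mulVec_transpose, dotProduct_comm, ← dotProduct_mulVec]
    simp only [star_trivial, sub_mulVec, smul_mulVec, add_mulVec, one_mulVec, dotProduct_sub,
      dotProduct_smul, dotProduct_add, ht, smul_eq_mul] at h
    linarith
  simp only [dotProduct_transpose_mul_self_mulVec] at hlow hupp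
  simp only [add_mulVec, smul_mulVec] at hu hw
  have huu := congrArg (u ⬝ᵥ ·) hu
  have hwu := congrArg (w ⬝ᵥ ·) hu
  have huw := congrArg (u ⬝ᵥ ·) hw
  have hww := congrArg (w ⬝ᵥ ·) hw
  simp only [dotProduct_add, dotProduct_sub, dotProduct_smul, smul_eq_mul,
    dotProduct_transpose_mul_self_mulVec] at huu hwu huw hww
  rw [dotProduct_comm w u] at hwu hww
  rw [dotProduct_comm (A *ᵥ w) (A *ᵥ u)] at hwu
  set N := u ⬝ᵥ u + w ⬝ᵥ w with hNdef
  set S := (A *ᵥ u) ⬝ᵥ (A *ᵥ u) + (A *ᵥ w) ⬝ᵥ (A *ᵥ w) with hSdef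
  set X := u ⬝ᵥ (A *ᵥ u) + w ⬝ᵥ (A *ᵥ w) with hXdef
  set Y := u ⬝ᵥ (A *ᵥ w) - w ⬝ᵥ (A *ᵥ u) with hYdef
  have hsq : ∀ v : Fin d → ℝ, 0 ≤ v ⬝ᵥ v := fun v =>
    Finset.sum_nonneg fun i _ => mul_self_nonneg (v i)
  have hXt : ∀ t : ℝ, 0 ≤ S - 2 * t * X + t ^ 2 * N := by
    intro t
    have h1 := hsq (A *ᵥ u - t • u)
    have h2 := hsq (A *ᵥ w - t • w)
    simp only [dotProduct_sub, sub_dotProduct, dotProduct_smul, smul_dotProduct,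
      smul_eq_mul, dotProduct_comm (A *ᵥ u) u, dotProduct_comm (A *ᵥ w) w] at h1 h2
    rw [hSdef, hXdef, hNdef]
    linarith
  have hYt : ∀ t : ℝ, 0 ≤ S - 2 * t * Y + t ^ 2 * N := by
    intro t
    have h1 := hsq (A *ᵥ w - t • u)
    have h2 := hsq (A *ᵥ u + t • w)
    simp only [dotProduct_sub, sub_dotProduct, dotProduct_add, add_dotProduct, dotProduct_smul,
      smul_dotProduct, smul_eq_mul, dotProduct_comm (A *ᵥ w) u,
      dotProduct_comm (A *ᵥ u) w] at h1 h2
    rw [hSdef, hYdef, hNdef]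
    linarith
  have abs_div_le : ∀ Z : ℝ, (∀ t : ℝ, 0 ≤ S - 2 * t * Z + t ^ 2 * N) →
      |Z / N| ≤ √(S / N) := by
    intro Z hZ
    apply Real.abs_le_sqrt
    have h := div_nonneg (hZ (Z / N)) hN.le
    have he : (S - 2 * (Z / N) * Z + (Z / N) ^ 2 * N) / N = S / N - (Z / N) ^ 2 := by
      field_simp
      ring
    linarith
  have hre : lam.re = X / N + τ * √(S / N) ^ 2 := by
    rw [Real.sq_sqrt (div_nonneg (add_nonneg (hsq _) (hsq _)) hN.le)]
    field_simp
    rw [hXdef, hNdef]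
    linarith
  have him : lam.im = Y / N := by
    field_simp
    rw [hYdef, hNdef]
    linarith
  rw [hre, him]
  refine sector_bounds hγ hμ hτ hτγ ?_ ?_ ?_ ((le_abs_self _).trans (abs_div_le X hXt))
    (abs_div_le Y hYt)
  · apply Real.le_sqrt_of_sq_le
    rw [le_div_iff₀ hN, hNdef, hSdef]
    linarith [hlow u, hlow w]
  · apply Real.sqrt_le_iff.mpr ⟨hγ.le.trans hγL, ?_⟩
    rw [div_le_iff₀ hN, hNdef, hSdef]
    linarith [hupp u, hupp w]
  · rw [le_div_iff₀ hN, hNdef, hXdef]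
    linarith [hsym u, hsym w]
end
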